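/- Let ν and μ_1, …, μ_C be probability measures on a measurable space α such that D_KL(μ_c ‖ ν) ≤ G for every c ∈ {1,…,C} and some G ≥ 0 (so each μ_c ≪ ν). Let g : α → ℝ be measurable with 0 ≤ g(x) ≤ M for all x, where M ≥ 0, and let w_1, …, w_C be nonnegative reals with Σ_{c=1}^C w_c = 1. Then Σ_{c=1}^C w_c ∫ g dμ_c ≤ ∫ g dν + M · √(G/2). -/

import Mathlib

open MeasureTheory

open InformationTheory ProbabilityTheory in
/-- The easy direction of the **Donsker–Varadhan variational formula**. -/
theorem integral_le_toReal_klDiv_add_log_integral_exp {α : Type*} [MeasurableSpace α]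
    {μ ν : Measure α} [IsProbabilityMeasure μ] [IsProbabilityMeasure ν] (hkl : klDiv μ ν ≠ ⊤)
    {f : α → ℝ} (hfμ : Integrable f μ) (hfν : Integrable (fun x ↦ Real.exp (f x)) ν) :
    ∫ x, f x ∂μ ≤ (klDiv μ ν).toReal + Real.log (∫ x, Real.exp (f x) ∂ν) := by
  obtain ⟨hac, hint⟩ := klDiv_ne_top_iff.mp hkl
  have : IsProbabilityMeasure (ν.tilted f) := isProbabilityMeasure_tilted hfν
  have h := integral_llr_add_sub_measure_univ_nonneg
    (hac.trans (absolutelyContinuous_tilted hfν)) (integrable_llr_tilted_right hac hfμ hint hfν)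
  rw [integral_llr_tilted_right hac hfμ hfν hint] at h
  rw [toReal_klDiv_of_measure_eq hac (by simp)]
  simp only [probReal_univ] at h
  linarith

open InformationTheory ProbabilityTheory in
/-- **Pinsker's inequality** in its dual form: the expectations of a bounded function under two
probability measures differ by at most its range times `√(KL / 2)`. -/
theorem integral_sub_integral_le_mul_sqrt_klDiv {α : Type*} [MeasurableSpace α]
    {μ ν : Measure α} [IsProbabilityMeasure μ] [IsProbabilityMeasure ν] (hkl : klDiv μ ν ≠ ⊤)
    {g : α → ℝ} (hg : Measurable g) {a b : ℝ} (hab : a ≤ b) (hg_mem : ∀ x, g x ∈ Set.Icc a b) :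
    ∫ x, g x ∂μ - ∫ x, g x ∂ν ≤ (b - a) * Real.sqrt ((klDiv μ ν).toReal / 2) := by
  have hgμ : Integrable g μ := .of_mem_Icc a b hg.aemeasurable (.of_forall hg_mem)
  have hsub := hasSubgaussianMGF_of_mem_Icc (μ := ν) hg.aemeasurable (.of_forall hg_mem)
  set K := (klDiv μ ν).toReal
  have hK : 0 ≤ K := ENNReal.toReal_nonneg
  set d := ∫ x, g x ∂μ - ∫ x, g x ∂ν
  have hquad (t : ℝ) : 0 ≤ (b - a) ^ 2 / 8 * (t * t) + -d * t + K := by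
    have hdv := integral_le_toReal_klDiv_add_log_integral_exp hkl
      (f := fun x ↦ t * (g x - ∫ y, g y ∂ν))
      ((hgμ.sub (integrable_const _)).const_mul t) (hsub.integrable_exp_mul t)
    rw [integral_const_mul, integral_sub hgμ (integrable_const _), integral_const,
      probReal_univ, one_smul] at hdv
    have hcgf := hsub.cgf_le t
    rw [cgf, mgf] at hcgf
    have hc : (((‖b - a‖₊ / 2) ^ 2 : NNReal) : ℝ) = (b - a) ^ 2 / 4 := by
      push_cast
      rw [Real.norm_eq_abs, div_pow, sq_abs]
      norm_num
    rw [hc] at hcgf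
    linarith
  have hdisc := discrim_le_zero hquad
  rw [discrim] at hdisc
  have hba : 0 ≤ b - a := sub_nonneg.mpr hab
  refine (abs_le_of_sq_le_sq' ?_ (by positivity)).2
  rw [mul_pow, Real.sq_sqrt (by positivity)]
  linarith

/-- Bounded gradient dissimilarity from bounded Kullback–Leibler divergence of the client label
distributions. `InformationTheory.klDiv μ ν` is `[0, ∞]`-valued; for probability measures it is
`∫ log (dμ/dν) dμ` if `μ ≪ ν` and the integral is finite, and `∞` otherwise. -/
theorem weighted_sum_integral_le_integral_add_sqrt_klDiv
    {α : Type*} [MeasurableSpace α] (C : ℕ)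
    (μ : Fin C → Measure α) (ν : Measure α)
    [∀ c, IsProbabilityMeasure (μ c)] [IsProbabilityMeasure ν]
    (G : ℝ) (hG : 0 ≤ G)
    (hkl : ∀ c, InformationTheory.klDiv (μ c) ν ≤ ENNReal.ofReal G)
    (g : α → ℝ) (hg : Measurable g) (M : ℝ) (hM : 0 ≤ M)
    (hg_bdd : ∀ x, 0 ≤ g x ∧ g x ≤ M)
    (w : Fin C → ℝ) (hw_nonneg : ∀ c, 0 ≤ w c) (hw_sum : ∑ c, w c = 1) :
    ∑ c, w c * ∫ x, g x ∂(μ c) ≤ (∫ x, g x ∂ν) + M * Real.sqrt (G / 2) := by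
  have hle (c : Fin C) : ∫ x, g x ∂(μ c) ≤ (∫ x, g x ∂ν) + M * Real.sqrt (G / 2) := by
    have h := integral_sub_integral_le_mul_sqrt_klDiv
      (ne_top_of_le_ne_top ENNReal.ofReal_ne_top (hkl c)) hg hM hg_bdd
    rw [sub_zero, sub_le_iff_le_add'] at h
    refine h.trans ?_
    gcongr
    exact ENNReal.toReal_le_of_le_ofReal hG (hkl c)
  calc ∑ c, w c * ∫ x, g x ∂(μ c)
      ≤ ∑ c, w c * ((∫ x, g x ∂ν) + M * Real.sqrt (G / 2)) :=
        Finset.sum_le_sum fun c _ ↦ mul_le_mul_of_nonneg_left (hle c) (hw_nonneg c)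
    _ = (∫ x, g x ∂ν) + M * Real.sqrt (G / 2) := by
        rw [← Finset.sum_mul, hw_sum, one_mul]
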